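/- Let α ∈ (0,1) be irrational, and let τ_S : ℝ → ℝ be the 1-periodic function given on [0,1] by τ_S(x) = (1−x)/(1+α) for 0 ≤ x ≤ 1−α, and τ_S(x) = (1−x)/(1+α) + (2−x)/(1+α) − (1−x)/α for 1−α < x ≤ 1. Let g : ℝ → ℝ be the continuous 1-periodic function given on [0,1) by g(x) = x(x−1)/(2α(1+α)). Then g solves the cohomological equation τ_S(x) − ∫₀¹ τ_S(t) dt = g(x) − g(x+α) for all x ∈ ℝ; consequently τ_S is a bounded remainder function with respect to α. -/

import Mathlib

open MeasureTheory

theorem statement19 (α : ℝ) (hα : α ∈ Set.Ioo (0:ℝ) 1) (hirr : Irrational α)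
    (τ g : ℝ → ℝ)
    -- `τ` is the 1-periodic function associated to the triangle with vertices
    -- `(0,0)`, `(1,0)`, `(0,1)`
    (hτper : ∀ x : ℝ, τ (x + 1) = τ x)
    (hτ1 : ∀ x ∈ Set.Icc (0:ℝ) (1 - α), τ x = (1 - x) / (1 + α))
    (hτ2 : ∀ x ∈ Set.Ioc (1 - α) (1:ℝ),
      τ x = (1 - x) / (1 + α) + (2 - x) / (1 + α) - (1 - x) / α)
    -- `g` is the continuous 1-periodic function `g(x) = x(x-1)/(2α(1+α))` on `[0,1)`
    (hgcont : Continuous g)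
    (hgper : ∀ x : ℝ, g (x + 1) = g x)
    (hg : ∀ x ∈ Set.Ico (0:ℝ) 1, g x = x * (x - 1) / (2 * α * (1 + α))) :
    -- `g` solves the cohomological equation for `τ` ...
    (∀ x : ℝ, τ x - (∫ t in (0:ℝ)..1, τ t) = g x - g (x + α)) ∧
    -- ... and consequently `τ` is a bounded remainder function with respect to `α`
    ∃ C : ℝ, ∀ N : ℕ, 1 ≤ N →
      |(∑ k ∈ Finset.range N, τ ((k : ℝ) * α)) -
        (N : ℝ) * ∫ t in (0:ℝ)..1, τ t| ≤ C := by
  obtain ⟨h0, h1⟩ := hα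
  have hne : α ≠ 0 := h0.ne'
  have hne1 : 1 + α ≠ 0 := by positivity
  have hτ2' : ∀ x ∈ Set.Icc (1 - α) (1:ℝ),
      τ x = (1 - x) / (1 + α) + (2 - x) / (1 + α) - (1 - x) / α := by
    intro x hx
    rcases eq_or_lt_of_le hx.1 with h | h
    · subst h
      rw [hτ1 _ ⟨by linarith, le_rfl⟩]
      field_simp
      ring
    · exact hτ2 x ⟨h, hx.2⟩
  have hu1 : Set.uIcc (0:ℝ) (1 - α) = Set.Icc 0 (1 - α) := Set.uIcc_of_le (by linarith)
  have hu2 : Set.uIcc (1 - α) (1:ℝ) = Set.Icc (1 - α) 1 := Set.uIcc_of_le (by linarith)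
  have hI1 : IntervalIntegrable τ volume 0 (1 - α) := by
    apply ContinuousOn.intervalIntegrable
    rw [hu1]
    refine ContinuousOn.congr (f := fun x => (1 - x) / (1 + α)) ?_ hτ1
    fun_prop
  have hI2 : IntervalIntegrable τ volume (1 - α) 1 := by
    apply ContinuousOn.intervalIntegrable
    rw [hu2]
    refine ContinuousOn.congr
      (f := fun x => (1 - x) / (1 + α) + (2 - x) / (1 + α) - (1 - x) / α) ?_ hτ2'
    fun_prop
  have hJ1 : (∫ t in (0:ℝ)..(1 - α), τ t) = (1 - α ^ 2) / (2 * (1 + α)) := by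
    rw [intervalIntegral.integral_eq_sub_of_hasDerivAt
      (f := fun x => (x - x ^ 2 / 2) / (1 + α)) _ hI1]
    · field_simp
      ring
    · intro x hx
      rw [hu1] at hx
      rw [hτ1 x hx]
      have := (((hasDerivAt_id x).sub (((hasDerivAt_id x).pow 2).div_const 2)).div_const (1 + α))
      refine HasDerivAt.congr_deriv this ?_
      simp
  have hJ2 : (∫ t in (1 - α)..(1:ℝ), τ t) = 1 / 2 - (1 - α ^ 2) / (2 * (1 + α)) := by
    rw [intervalIntegral.integral_eq_sub_of_hasDerivAt
      (f := fun x => (3 * x - x ^ 2) / (1 + α) - (x - x ^ 2 / 2) / α) _ hI2]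
    · field_simp
      ring
    · intro x hx
      rw [hu2] at hx
      rw [hτ2' x hx]
      have := ((((hasDerivAt_id x).const_mul 3).sub ((hasDerivAt_id x).pow 2)).div_const
        (1 + α)).sub
        (((hasDerivAt_id x).sub (((hasDerivAt_id x).pow 2).div_const 2)).div_const α)
      refine HasDerivAt.congr_deriv this ?_
      simp
      ring
  have hI : (∫ t in (0:ℝ)..1, τ t) = 1 / 2 := by
    rw [← intervalIntegral.integral_add_adjacent_intervals hI1 hI2, hJ1, hJ2]
    ring
  have hg' : ∀ x ∈ Set.Icc (0:ℝ) 1, g x = x * (x - 1) / (2 * α * (1 + α)) := by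
    intro x hx
    rcases eq_or_lt_of_le hx.2 with h | h
    · subst h
      have := hgper 0
      rw [zero_add] at this
      rw [this, hg 0 ⟨le_rfl, one_pos⟩]
      simp
    · exact hg x ⟨hx.1, h⟩
  have hbase : ∀ x ∈ Set.Ico (0:ℝ) 1, τ x - 1 / 2 = g x - g (x + α) := by
    intro x hx
    rcases le_or_gt x (1 - α) with h | h
    · rw [hτ1 x ⟨hx.1, h⟩, hg x hx, hg' (x + α) ⟨by linarith [hx.1], by linarith⟩]
      field_simp
      ring
    · have e : x + α = (x + α - 1) + 1 := by ring
      rw [hτ2 x ⟨h, hx.2.le⟩, hg x hx, e, hgper,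
        hg' (x + α - 1) ⟨by linarith, by linarith [hx.2]⟩]
      field_simp
      ring
  have hτf : ∀ x, τ (Int.fract x) = τ x := fun x => by
    have hp : Function.Periodic τ 1 := hτper
    have := hp.sub_int_mul_eq (x := x) ⌊x⌋
    rwa [mul_one] at this
  have hgp : Function.Periodic g 1 := hgper
  have hcoh : ∀ x, τ x - (∫ t in (0:ℝ)..1, τ t) = g x - g (x + α) := by
    intro x
    have hb := hbase (Int.fract x) ⟨Int.fract_nonneg x, Int.fract_lt_one x⟩
    have e1 : g (Int.fract x) = g x := by
      have := hgp.sub_int_mul_eq (x := x) ⌊x⌋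
      rwa [mul_one] at this
    have e2 : g (Int.fract x + α) = g (x + α) := by
      have := hgp.sub_int_mul_eq (x := x + α) ⌊x⌋
      rw [mul_one] at this
      rw [← this]
      congr 1
      rw [Int.fract]
      ring
    rw [hI, ← hτf x, hb, e1, e2]
  refine ⟨hcoh, ?_⟩
  obtain ⟨M, hM⟩ := isCompact_Icc.exists_bound_of_continuousOn
    (s := Set.Icc (0:ℝ) 1) hgcont.continuousOn
  have hM' : ∀ x, |g x| ≤ M := by
    intro x
    have e1 : g (Int.fract x) = g x := by
      have := hgp.sub_int_mul_eq (x := x) ⌊x⌋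
      rwa [mul_one] at this
    rw [← e1]
    exact hM _ ⟨Int.fract_nonneg x, (Int.fract_lt_one x).le⟩
  refine ⟨2 * M, fun N _ => ?_⟩
  have key : ∀ N : ℕ, (∑ k ∈ Finset.range N, τ ((k : ℝ) * α)) -
        (N : ℝ) * (∫ t in (0:ℝ)..1, τ t) = g 0 - g (N * α) := by
    intro N
    induction N with
    | zero => simp
    | succ n ih =>
      have h := hcoh (n * α)
      have e : ((n + 1 : ℕ) : ℝ) * α = n * α + α := by push_cast; ring
      rw [Finset.sum_range_succ, e]
      push_cast
      linarith
  rw [key N]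
  have a := abs_le.1 (hM' 0)
  have b := abs_le.1 (hM' (N * α))
  rw [abs_le]
  constructor <;> linarith [a.1, a.2, b.1, b.2]
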